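/- If a first-order L-theory T is κ-rich, then Mod(T) is bitotally bisimilar with Mod_{κ⁺}(T): there is a bitotal bisimulation between the potentialist system of all models of T and the subsystem consisting of those models of cardinality at most κ. In particular, Mod(T) is bitotally bisimilar with a set-sized potentialist system. -/

import Mathlib

open FirstOrder Language

namespace Potentialist

/-- The underlying data of a potentialist system: a collection of worlds, each carrying a
first-order `L`-structure. -/
structure PreSys.{u, v, w, x} (L : FirstOrder.Language.{u, v}) where
  World : Type w
  Dom : World → Type x
  str : ∀ W, L.Structure (Dom W)

attribute [instance] PreSys.str

/-- A potentialist system: a collection of first-order `L`-structures together with a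
collection of `L`-embeddings between them, containing all identity embeddings and closed
under composition. -/
structure PotSys.{u, v, w, x} (L : FirstOrder.Language.{u, v})
    extends PreSys.{u, v, w, x} L where
  Emb : ∀ W W' : World, Set (Dom W ↪[L] Dom W')
  id_mem : ∀ W : World, Embedding.refl L (Dom W) ∈ Emb W W
  comp_mem : ∀ {W W' W'' : World} (f : Dom W ↪[L] Dom W') (g : Dom W' ↪[L] Dom W''),
    f ∈ Emb W W' → g ∈ Emb W' W'' → g.comp f ∈ Emb W W''

/-- Two tuples (in possibly different structures) satisfy the same atomic `L`-formulas. -/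
def AtomicEquiv.{u, v, y, z} (L : FirstOrder.Language.{u, v}) {M : Type y} {N : Type z}
    [L.Structure M] [L.Structure N] {n : ℕ} (a : Fin n → M) (b : Fin n → N) : Prop :=
  ∀ φ : L.Formula (Fin n), BoundedFormula.IsAtomic φ → (φ.Realize a ↔ φ.Realize b)

/-- The type of relations between pairs `(M, ā)` and `(N, b̄)` of equal parameter size. -/
abbrev BisimRel.{u, v, w, x, w', x'} {L : FirstOrder.Language.{u, v}}
    (S : PotSys.{u, v, w, x} L) (T : PotSys.{u, v, w', x'} L) :=
  ∀ (n : ℕ) (M : S.World), (Fin n → S.Dom M) → ∀ N : T.World, (Fin n → T.Dom N) → Prop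

/-- `R` is a bisimulation between the potentialist systems `S` and `T`: it is nonempty, and
whenever `R` relates `(M, ā)` to `(N, b̄)`: (B1) `ā` and `b̄` satisfy the same atomic formulas;
(B2) any extension of either tuple by one element can be matched on the other side;
(B3) any embedding on either side can be matched by an embedding on the other side. -/
def IsBisimulation.{u, v, w, x, w', x'} {L : FirstOrder.Language.{u, v}}
    (S : PotSys.{u, v, w, x} L) (T : PotSys.{u, v, w', x'} L) (R : BisimRel S T) : Prop :=
  (∃ n M a N b, R n M a N b) ∧
  ∀ (n : ℕ) (M : S.World) (a : Fin n → S.Dom M) (N : T.World) (b : Fin n → T.Dom N),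
    R n M a N b →
      AtomicEquiv L a b ∧
      (∀ c : S.Dom M, ∃ d : T.Dom N, R (n + 1) M (Fin.snoc a c) N (Fin.snoc b d)) ∧
      (∀ d : T.Dom N, ∃ c : S.Dom M, R (n + 1) M (Fin.snoc a c) N (Fin.snoc b d)) ∧
      (∀ (M' : S.World) (π : S.Dom M ↪[L] S.Dom M'), π ∈ S.Emb M M' →
        ∃ (N' : T.World) (ρ : T.Dom N ↪[L] T.Dom N'), ρ ∈ T.Emb N N' ∧
          R n M' (fun i => π (a i)) N' (fun i => ρ (b i))) ∧
      (∀ (N' : T.World) (ρ : T.Dom N ↪[L] T.Dom N'), ρ ∈ T.Emb N N' →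
        ∃ (M' : S.World) (π : S.Dom M ↪[L] S.Dom M'), π ∈ S.Emb M M' ∧
          R n M' (fun i => π (a i)) N' (fun i => ρ (b i)))

/-- Two pointed systems are bisimilar if some bisimulation relates them. -/
def Bisimilar.{u, v, w, x, w', x'} {L : FirstOrder.Language.{u, v}}
    (S : PotSys.{u, v, w, x} L) (T : PotSys.{u, v, w', x'} L)
    {n : ℕ} (M : S.World) (a : Fin n → S.Dom M) (N : T.World) (b : Fin n → T.Dom N) : Prop :=
  ∃ R : BisimRel S T, IsBisimulation S T R ∧ R n M a N b

/-- A relation is bitotal if every pair on the left is related to some pair on the right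
and vice versa. -/
def Bitotal.{u, v, w, x, w', x'} {L : FirstOrder.Language.{u, v}}
    (S : PotSys.{u, v, w, x} L) (T : PotSys.{u, v, w', x'} L) (R : BisimRel S T) : Prop :=
  (∀ (n : ℕ) (M : S.World) (a : Fin n → S.Dom M), ∃ N b, R n M a N b) ∧
  (∀ (n : ℕ) (N : T.World) (b : Fin n → T.Dom N), ∃ M a, R n M a N b)

/-- Two potentialist systems are bitotally bisimilar if there is a bitotal bisimulation
between them. -/
def BitotallyBisimilar.{u, v, w, x, w', x'} {L : FirstOrder.Language.{u, v}}
    (S : PotSys.{u, v, w, x} L) (T : PotSys.{u, v, w', x'} L) : Prop :=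
  ∃ R : BisimRel S T, IsBisimulation S T R ∧ Bitotal S T R

/-- An iso-bisimulation between potentialist systems: a nonempty relation between worlds
together with a system of isomorphisms, such that embeddings on either side can be matched
by embeddings on the other side, commuting with the isomorphisms. -/
structure IsoBisim.{u, v, w, x, w', x'} {L : FirstOrder.Language.{u, v}}
    (S : PotSys.{u, v, w, x} L) (T : PotSys.{u, v, w', x'} L) where
  rel : S.World → T.World → Prop
  nonempty : ∃ M N, rel M N
  iso : ∀ {M : S.World} {N : T.World}, rel M N → (S.Dom M ≃[L] T.Dom N)
  forth : ∀ {M : S.World} {N : T.World} (h : rel M N) (M' : S.World)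
      (π : S.Dom M ↪[L] S.Dom M'), π ∈ S.Emb M M' →
      ∃ (N' : T.World) (ρ : T.Dom N ↪[L] T.Dom N') (_ : ρ ∈ T.Emb N N') (h' : rel M' N'),
        ∀ y : S.Dom M, iso h' (π y) = ρ (iso h y)
  back : ∀ {M : S.World} {N : T.World} (h : rel M N) (N' : T.World)
      (ρ : T.Dom N ↪[L] T.Dom N'), ρ ∈ T.Emb N N' →
      ∃ (M' : S.World) (π : S.Dom M ↪[L] S.Dom M') (_ : π ∈ S.Emb M M') (h' : rel M' N'),
        ∀ y : S.Dom M, iso h' (π y) = ρ (iso h y)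

/-- An iso-bisimulation is bitotal if every world on either side takes part in the relation. -/
def IsoBisim.Bitotal.{u, v, w, x, w', x'} {L : FirstOrder.Language.{u, v}}
    {S : PotSys.{u, v, w, x} L} {T : PotSys.{u, v, w', x'} L} (I : IsoBisim S T) : Prop :=
  (∀ M : S.World, ∃ N, I.rel M N) ∧ (∀ N : T.World, ∃ M, I.rel M N)


/-- A model of a theory `T` realized concretely on a (set-sized) subset of a fixed ambient
class `A`. -/
structure CModel.{u, v} (L : FirstOrder.Language.{u, v}) (T : L.Theory)
    (A : Type (max u v + 1)) where
  carrier : Set A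
  small : Small.{max u v} (carrier : Type (max u v + 1))
  struc : L.Structure carrier
  models : @Theory.Model L carrier struc T

attribute [instance] CModel.struc

/-- The substructure potentialist system `Mod(T)`: its worlds are all models of `T` carried
on subsets of the ambient class `A`, and its embeddings are exactly the substructure
inclusion maps. -/
def ModSub.{u, v} (L : FirstOrder.Language.{u, v}) (T : L.Theory)
    (A : Type (max u v + 1)) : PotSys.{u, v, max u v + 1, max u v + 1} L where
  World := CModel L T A
  Dom M := M.carrier
  str M := M.struc
  Emb M N := {f : M.carrier ↪[L] N.carrier | ∀ y : M.carrier, (f y : A) = (y : A)}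
  id_mem M := fun y => rfl
  comp_mem f g hf hg := fun y => (hg (f y)).trans (hf y)

/-- The embedding potentialist system `Mod_e(T)`: its worlds are all models of `T` carried
on subsets of the ambient class `A`, and it contains all `L`-embeddings between them. -/
def ModEmb.{u, v} (L : FirstOrder.Language.{u, v}) (T : L.Theory)
    (A : Type (max u v + 1)) : PotSys.{u, v, max u v + 1, max u v + 1} L where
  World := CModel L T A
  Dom M := M.carrier
  str M := M.struc
  Emb M N := Set.univ
  id_mem M := trivial
  comp_mem _ _ _ _ := trivial

/-- The subsystem `Mod_{κ⁺}(T)` of the substructure potentialist system `Mod(T)` consisting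
of the models of cardinality at most `κ`. -/
def ModSubLe.{u, v} (L : FirstOrder.Language.{u, v}) (T : L.Theory)
    (A : Type (max u v + 1)) (κ : Cardinal.{max u v}) :
    PotSys.{u, v, max u v + 1, max u v + 1} L where
  World := {M : CModel L T A // Cardinal.mk M.carrier ≤ Cardinal.lift.{max u v + 1} κ}
  Dom M := M.1.carrier
  str M := M.1.struc
  Emb M N := {f : M.1.carrier ↪[L] N.1.carrier | ∀ y : M.1.carrier, (f y : A) = (y : A)}
  id_mem M := fun y => rfl
  comp_mem f g hf hg := fun y => (hg (f y)).trans (hf y)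

/-- A structure `M` is `ℵ₀`-saturated if for every finite tuple `ā` of elements of `M`,
every type `p(x)` over the parameters `ā` that is finitely realized in `M` is realized
in `M`. -/
def Aleph0Saturated.{u, v, y} (L : FirstOrder.Language.{u, v}) (M : Type y)
    [L.Structure M] : Prop :=
  ∀ (n : ℕ) (a : Fin n → M) (p : Set (L.Formula (Fin (n + 1)))),
    (∀ s : Finset (L.Formula (Fin (n + 1))), ↑s ⊆ p →
      ∃ c : M, ∀ φ ∈ s, Formula.Realize φ (Fin.snoc a c)) →
    ∃ c : M, ∀ φ ∈ p, Formula.Realize φ (Fin.snoc a c)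

/-- A theory `T` is `κ`-rich, for `κ ≥ |L| + ℵ₀`, if it has an infinite model and all its
models of cardinality `κ` are `ℵ₀`-saturated. -/
def Rich.{u, v} (L : FirstOrder.Language.{u, v}) (T : L.Theory)
    (κ : Cardinal.{max u v}) : Prop :=
  Language.card L + Cardinal.aleph0 ≤ κ ∧
  (∃ (M : Type max u v) (_ : L.Structure M), M ⊨ T ∧ Infinite M) ∧
  ∀ (M : Type max u v) (_ : L.Structure M), M ⊨ T → Cardinal.mk M = κ → Aleph0Saturated L M

/-- A theory is `κ`-categorical if any two of its models of cardinality `κ` are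
isomorphic. -/
def Categorical.{u, v} (L : FirstOrder.Language.{u, v}) (T : L.Theory)
    (κ : Cardinal.{max u v}) : Prop :=
  ∀ (M N : Type max u v) (_ : L.Structure M) (_ : L.Structure N),
    M ⊨ T → N ⊨ T → Cardinal.mk M = κ → Cardinal.mk N = κ → Nonempty (M ≃[L] N)

/-- A theory is `ℵ₀`-categorical if any two of its countably infinite models are
isomorphic. -/
def Aleph0Categorical.{u, v} (L : FirstOrder.Language.{u, v}) (T : L.Theory) : Prop :=
  ∀ (M N : Type max u v) (_ : L.Structure M) (_ : L.Structure N),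
    M ⊨ T → N ⊨ T → Countable M → Infinite M → Countable N → Infinite N →
      Nonempty (M ≃[L] N)

/-- A theory `T` has quantifier elimination if every `L`-formula is `T`-equivalent to a
quantifier-free formula with the same free variables. -/
def HasQE.{u, v} (L : FirstOrder.Language.{u, v}) (T : L.Theory) : Prop :=
  ∀ (n : ℕ) (φ : L.Formula (Fin n)), ∃ ψ : L.Formula (Fin n),
    BoundedFormula.IsQF ψ ∧
    ∀ (M : Type max u v) (_ : L.Structure M), M ⊨ T →
      ∀ a : Fin n → M, Formula.Realize φ a ↔ Formula.Realize ψ a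

/-- The theory of a potentialist system: the set of (finitary, non-modal) `L`-sentences
which hold in every world. -/
def ThOf.{u, v, w, x} {L : FirstOrder.Language.{u, v}} (S : PotSys.{u, v, w, x} L) :
    L.Theory :=
  {φ : L.Sentence | ∀ W : S.World, S.Dom W ⊨ φ}


section Realize

universe u v w

variable {L : FirstOrder.Language.{u, v}} {P Q : Type w} [L.Structure P] [L.Structure Q]

/-- The tuples `a` and `b` satisfy the same first-order formulas. -/
def ElemEquiv (L : FirstOrder.Language.{u, v}) [L.Structure P] [L.Structure Q] {n : ℕ}
    (a : Fin n → P) (b : Fin n → Q) : Prop :=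
  ∀ φ : L.Formula (Fin n), φ.Realize a ↔ φ.Realize b

theorem ElemEquiv.symm {n : ℕ} {a : Fin n → P} {b : Fin n → Q} (h : ElemEquiv L a b) :
    ElemEquiv L b a :=
  fun φ => (h φ).symm

theorem ElemEquiv.of_forall_imp {n : ℕ} {a : Fin n → P} {b : Fin n → Q}
    (h : ∀ φ : L.Formula (Fin n), φ.Realize a → φ.Realize b) : ElemEquiv L a b := fun φ =>
  ⟨h φ, fun hb => by_contra fun ha =>
    Formula.realize_not.1 (h φ.not (Formula.realize_not.2 ha)) hb⟩

theorem ElemEquiv.models {n : ℕ} {a : Fin n → P} {b : Fin n → Q} (h : ElemEquiv L a b)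
    {T : L.Theory} (hP : P ⊨ T) : Q ⊨ T := by
  refine ⟨fun φ hφ => ?_⟩
  have h' := (h (Formula.relabel (Empty.elim : Empty → Fin n) φ)).1
  rw [Formula.realize_relabel, Formula.realize_relabel, Subsingleton.elim (a ∘ _) default,
    Subsingleton.elim (b ∘ _) default] at h'
  exact h' (hP.realize_of_mem φ hφ)

theorem exists_realize_snoc_iff {n : ℕ} (φ : L.Formula (Fin (n + 1))) :
    ∃ ψ : L.Formula (Fin n), ∀ (M : Type w) [L.Structure M] (a : Fin n → M),
      ψ.Realize a ↔ ∃ c : M, φ.Realize (Fin.snoc a c : Fin (n + 1) → M) := by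
  refine ⟨Formula.iExs (Fin 1) (φ.relabel finSumFinEquiv.symm), fun M _ a => ?_⟩
  have key : ∀ i : Fin 1 → M,
      (Sum.elim a i ∘ finSumFinEquiv.symm : Fin (n + 1) → M) = Fin.snoc a (i 0) := by
    intro i
    funext j
    refine Fin.lastCases ?_ (fun k => ?_) j
    · have : (finSumFinEquiv.symm (Fin.last n) : Fin n ⊕ Fin 1) = Sum.inr 0 := by
        rw [Equiv.symm_apply_eq]; rfl
      simp [this]
    · have : (finSumFinEquiv.symm (Fin.castSucc k) : Fin n ⊕ Fin 1) = Sum.inl k := by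
        rw [Equiv.symm_apply_eq]; rfl
      simp [this]
  rw [Formula.realize_iExs]
  simp only [Formula.realize_relabel, key]
  exact ⟨fun ⟨i, hi⟩ => ⟨_, hi⟩, fun ⟨c, hc⟩ => ⟨fun _ => c, hc⟩⟩

theorem ElemEquiv.exists_snoc {n : ℕ} {a : Fin n → P} {b : Fin n → Q} (h : ElemEquiv L a b)
    (hQ : Aleph0Saturated L Q) (c : P) :
    ∃ d : Q, ElemEquiv L (Fin.snoc a c : Fin (n + 1) → P) (Fin.snoc b d : Fin (n + 1) → Q) := by
  obtain ⟨d, hd⟩ := hQ n b {φ | φ.Realize (Fin.snoc a c : Fin (n + 1) → P)} fun s hs => by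
    obtain ⟨ψ, hψ⟩ := exists_realize_snoc_iff.{u, v, w}
      (Formula.iInf fun φ : s => (φ : L.Formula (Fin (n + 1))))
    have ha := (h ψ).1 ((hψ P a).2 ⟨c, Formula.realize_iInf.2 fun φ => hs φ.2⟩)
    obtain ⟨d, hd⟩ := (hψ Q b).1 ha
    exact ⟨d, fun φ hφ => Formula.realize_iInf.1 hd ⟨φ, hφ⟩⟩
  exact ⟨d, .of_forall_imp hd⟩

open scoped Classical in
/-- If `b` and `a` satisfy the same formulas, then any formula with parameters in `Q` that is
satisfied in `Q` can be satisfied in `P` by a valuation sending `b` to `a`. -/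
theorem ElemEquiv.exists_valuation [Nonempty P] {n : ℕ} {a : Fin n → P} {b : Fin n → Q}
    (h : ElemEquiv L a b) (θ : L.Formula Q) (hθ : θ.Realize (id : Q → Q)) :
    ∃ v : Q → P, v ∘ b = a ∧ θ.Realize v := by
  let F : Finset Q := θ.freeVarFinset ∪ Finset.univ.image b
  have hbF : ∀ i, b i ∈ F := fun i =>
    Finset.mem_union_right _ (Finset.mem_image_of_mem _ (Finset.mem_univ _))
  let θ' : L.Formula F := BoundedFormula.restrictFreeVar θ
    fun q => ⟨q, Finset.mem_union_left _ q.2⟩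
  let Θ : L.Formula (Fin n ⊕ F) := θ'.relabel Sum.inr ⊓
    Formula.iInf fun i : Fin n => Term.equal (Term.var (Sum.inl i))
      (Term.var (Sum.inr ⟨b i, hbF i⟩))
  have hΘ : (Θ.iExs F).Realize b := by
    rw [Formula.realize_iExs]
    refine ⟨fun q => q, Formula.realize_inf.2 ⟨?_, Formula.realize_iInf.2 fun i => ?_⟩⟩
    · rw [Formula.realize_relabel]
      exact (BoundedFormula.realize_restrictFreeVar (v := fun q : F => (q : Q)) id
        fun _ => rfl).2 hθ
    · simp
  obtain ⟨v, hv⟩ := Formula.realize_iExs.1 ((h _).2 hΘ)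
  obtain ⟨hv₁, hv₂⟩ := Formula.realize_inf.1 hv
  have hv₂ := Formula.realize_iInf.1 hv₂
  let v' : Q → P := fun q => if hq : q ∈ F then v ⟨q, hq⟩ else Classical.arbitrary P
  refine ⟨v', funext fun i => ?_, ?_⟩
  · have := hv₂ i
    simp only [Formula.realize_equal, Term.realize_var, Sum.elim_inl, Sum.elim_inr] at this
    simp [v', hbF i, this]
  · rw [Formula.realize_relabel] at hv₁
    refine (BoundedFormula.realize_restrictFreeVar v' fun q => ?_).1 hv₁
    have : (q : Q) ∈ F := Finset.mem_union_left _ q.2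
    simp [v', this]

end Realize

section Compactness

universe u v

variable {L : FirstOrder.Language.{u, v}} {P P' Q : Type max u v}
  [L.Structure P] [L.Structure P'] [L.Structure Q]

open scoped Classical in
theorem exists_valuation_of_finitely_realized {α : Type max u v} [Nonempty P]
    (Γ : Set (L.Formula α))
    (h : ∀ s : Finset (L.Formula α), ↑s ⊆ Γ → ∃ v : α → P, ∀ ψ ∈ s, ψ.Realize v) :
    ∃ (M : Type max u v) (_ : L.Structure M) (v : α → M), ∀ ψ ∈ Γ, ψ.Realize v := by
  have hsat : Theory.IsSatisfiable (Formula.equivSentence '' Γ : (L[[α]]).Theory) := by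
    rw [Theory.isSatisfiable_iff_isFinitelySatisfiable]
    intro T₀ hT₀
    obtain ⟨v, hv⟩ := h (T₀.image Formula.equivSentence.symm) fun ψ hψ => by
      obtain ⟨χ, hχ, rfl⟩ := Finset.mem_image.1 (Finset.mem_coe.1 hψ)
      obtain ⟨ψ, hψ, rfl⟩ := hT₀ hχ
      rwa [Equiv.symm_apply_apply]
    let := constantsOn.structure v
    have : P ⊨ (T₀ : (L[[α]]).Theory) := ⟨fun χ hχ =>
      (Formula.realize_equivSentence_symm P χ v).1 (hv _ (Finset.mem_image_of_mem _ hχ))⟩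
    exact Theory.Model.isSatisfiable P
  obtain ⟨M⟩ := hsat
  let : L.Structure M := (L.lhomWithConstants α).reduct M
  have : (L.lhomWithConstants α).IsExpansionOn M := LHom.isExpansionOn_reduct _ _
  exact ⟨M, inferInstance, fun x => (L.con x : M), fun ψ hψ =>
    (Formula.realize_equivSentence M ψ).1
      (Theory.realize_sentence_of_mem _ (Set.mem_image_of_mem _ hψ))⟩

open scoped Classical in
/-- An extension of `P` can be amalgamated with `Q` over tuples satisfying the same formulas,
up to elementary equivalence. -/
theorem ElemEquiv.exists_embedding [Nonempty P] {n : ℕ} {a : Fin n → P} {b : Fin n → Q}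
    (h : ElemEquiv L a b) (f : P ↪[L] P') :
    ∃ (M : Type max u v) (_ : L.Structure M) (g : Q ↪[L] M), ElemEquiv L (f ∘ a) (g ∘ b) := by
  have : Nonempty P' := ‹Nonempty P›.map f
  let Δ : Set (L.Formula Q) :=
    {ψ | ψ.Realize (id : Q → Q) ∧ ∀ v : Q → P, ψ.Realize v → ψ.Realize (f ∘ v)}
  let E : Set (L.Formula Q) :=
    (fun φ : L.Formula (Fin n) => φ.relabel b) '' {φ | φ.Realize (f ∘ a)}
  obtain ⟨M, _, g, hg⟩ := exists_valuation_of_finitely_realized (P := P') (Δ ∪ E) fun s hs => by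
    obtain ⟨v, hva, hv⟩ := h.exists_valuation
      (Formula.iInf fun ψ : s.filter (· ∈ Δ) => (ψ : L.Formula Q))
      (Formula.realize_iInf.2 fun ψ => (Finset.mem_filter.1 ψ.2).2.1)
    refine ⟨f ∘ v, fun ψ hψ => ?_⟩
    rcases hs hψ with hΔ | ⟨φ, hφ, rfl⟩
    · exact hΔ.2 v (Formula.realize_iInf.1 hv ⟨ψ, Finset.mem_filter.2 ⟨hψ, hΔ⟩⟩)
    · rw [Formula.realize_relabel, Function.comp_assoc, hva]
      exact hφ
  have hΔ : ∀ ψ ∈ Δ, ψ.Realize g := fun ψ hψ => hg ψ (Or.inl hψ)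
  let g' : Q ↪[L] M :=
    { toFun := g
      inj' := fun q r hqr => by
        by_contra hne
        have := hΔ (Term.equal (Term.var q) (Term.var r)).not
          ⟨by simpa using hne, fun v hv => by simpa using hv⟩
        simp [hqr] at this
      map_fun' := fun F x => by
        have := hΔ (Term.equal (Term.func F fun i => Term.var (x i))
          (Term.var (Structure.funMap F x))) ⟨by simp, fun v hv => by
            simp only [Formula.realize_equal, Term.realize_func, Term.realize_var] at hv ⊢
            simp only [Function.comp_apply, ← hv, f.map_fun]
            rfl⟩
        simp only [Formula.realize_equal, Term.realize_func, Term.realize_var] at this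
        exact this.symm
      map_rel' := fun R x => by
        have hR : ∀ v : Q → P, ((R.formula fun i => Term.var (x i)).Realize (f ∘ v) ↔
            (R.formula fun i => Term.var (x i)).Realize v) := fun v => by
          simp only [Formula.realize_rel, Term.realize_var]
          exact f.map_rel R (fun i => v (x i))
        refine ⟨fun hM => by_contra fun hQ => ?_, fun hQ => ?_⟩
        · have := hΔ (R.formula fun i => Term.var (x i)).not
            ⟨by simpa [Formula.realize_rel] using hQ, fun v hv => by
              rw [Formula.realize_not] at hv ⊢
              rwa [hR]⟩
          simp only [Formula.realize_not, Formula.realize_rel, Term.realize_var] at this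
          exact this hM
        · have := hΔ (R.formula fun i => Term.var (x i))
            ⟨by simpa [Formula.realize_rel] using hQ, fun v hv => (hR v).2 hv⟩
          simp only [Formula.realize_rel, Term.realize_var] at this
          exact this }
  refine ⟨M, inferInstance, g', .of_forall_imp fun φ hφ => ?_⟩
  exact Formula.realize_relabel.1 (hg (φ.relabel b) (Or.inr ⟨φ, hφ, rfl⟩))

theorem exists_elementarySubstructure_card_le (P : Type max u v) [L.Structure P] (s : Set P)
    {μ : Cardinal.{max u v}} (hμ : L.card + Cardinal.aleph0 ≤ μ) (hs : Cardinal.mk s ≤ μ) :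
    ∃ S : L.ElementarySubstructure P, s ⊆ S ∧ Cardinal.mk S ≤ μ ∧
      (μ ≤ Cardinal.mk P → Cardinal.mk S = μ) := by
  rcases le_or_gt μ (Cardinal.mk P) with hP | hP
  · obtain ⟨S, hsS, hS⟩ := exists_elementarySubstructure_card_eq L s μ
      (le_add_self.trans hμ) (by simpa using hs)
      (by simpa using le_self_add.trans hμ) (by simpa using hP)
    have hS : Cardinal.mk S = μ := by simpa using hS
    exact ⟨S, hsS, hS.le, fun _ => hS⟩
  · exact ⟨⊤, fun _ _ => trivial, (Cardinal.mk_subtype_le _).trans hP.le,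
      fun h => absurd h hP.not_ge⟩

theorem mk_range_fin_le {X : Type max u v} {n : ℕ} (a : Fin n → X) {μ : Cardinal.{max u v}}
    (hμ : L.card + Cardinal.aleph0 ≤ μ) : Cardinal.mk (Set.range a) ≤ μ :=
  (Cardinal.mk_le_aleph0_iff.2 (Set.countable_range a).to_subtype).trans (le_add_self.trans hμ)

theorem elemEquiv_coe (S : L.ElementarySubstructure P) {n : ℕ}
    (b : Fin n → S) : ElemEquiv L (fun i => (b i : P)) b :=
  fun φ => S.subtype.map_formula φ b

theorem Rich.aleph0Saturated {T : L.Theory} {κ : Cardinal.{max u v}} (h : Rich L T κ)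
    (hT : P ⊨ T) (hP : κ ≤ Cardinal.mk P) : Aleph0Saturated L P := by
  intro n a p hp
  obtain ⟨S, haS, -, hS⟩ :=
    exists_elementarySubstructure_card_le P (Set.range a) h.1 (mk_range_fin_le a h.1)
  let a' : Fin n → S := fun i => ⟨a i, haS ⟨i, rfl⟩⟩
  have key : ∀ (c : S) (φ : L.Formula (Fin (n + 1))),
      φ.Realize (Fin.snoc a c : Fin (n + 1) → P) ↔
        φ.Realize (Fin.snoc a' c : Fin (n + 1) → S) := fun c φ => by
    rw [← S.subtype.map_formula φ]
    exact iff_of_eq (congrArg _ (Fin.comp_snoc S.subtype a' c).symm)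
  obtain ⟨c, hc⟩ := h.2.2 S inferInstance (S.theory_model_iff T |>.2 hT) (hS hP) n a' p
    fun s hs => by
      obtain ⟨ψ, hψ⟩ := exists_realize_snoc_iff.{u, v, max u v}
        (Formula.iInf fun φ : s => (φ : L.Formula (Fin (n + 1))))
      obtain ⟨c, hc⟩ := hp s hs
      have h₁ := (hψ P a).2 ⟨c, Formula.realize_iInf.2 fun φ => hc φ φ.2⟩
      obtain ⟨d, hd⟩ := (hψ S a').1 ((S.subtype.map_formula ψ a').1 h₁)
      exact ⟨d, fun φ hφ => Formula.realize_iInf.1 hd ⟨φ, hφ⟩⟩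
  exact ⟨c, fun φ hφ => (key c φ).2 (hc φ hφ)⟩

/-- `P` and `Q` are isomorphic by a map sending `a` to `b`, or else both have cardinality at
least `κ` and `a` and `b` satisfy the same formulas. -/
def Similar (L : FirstOrder.Language.{u, v}) (κ : Cardinal.{max u v}) [L.Structure P]
    [L.Structure Q] {n : ℕ} (a : Fin n → P) (b : Fin n → Q) : Prop :=
  (∃ e : P ≃[L] Q, e ∘ a = b) ∨
    (κ ≤ Cardinal.mk P ∧ κ ≤ Cardinal.mk Q ∧ ElemEquiv L a b)

variable {T : L.Theory} {κ : Cardinal.{max u v}}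

theorem Similar.symm {n : ℕ} {a : Fin n → P} {b : Fin n → Q} (h : Similar L κ a b) :
    Similar L κ b a := by
  rcases h with ⟨e, rfl⟩ | ⟨hP, hQ, h⟩
  · exact Or.inl ⟨e.symm, funext fun i => e.symm_apply_apply _⟩
  · exact Or.inr ⟨hQ, hP, h.symm⟩

theorem Similar.elemEquiv {n : ℕ} {a : Fin n → P} {b : Fin n → Q} (h : Similar L κ a b) :
    ElemEquiv L a b := by
  rcases h with ⟨e, rfl⟩ | ⟨-, -, h⟩
  · exact fun φ => (StrongHomClass.realize_formula e φ).symm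
  · exact h

theorem Similar.exists_snoc (hT : Rich L T κ) (hQ : Q ⊨ T) {n : ℕ} {a : Fin n → P}
    {b : Fin n → Q} (h : Similar L κ a b) (c : P) :
    ∃ d : Q, Similar L κ (Fin.snoc a c : Fin (n + 1) → P) (Fin.snoc b d : Fin (n + 1) → Q) := by
  rcases h with ⟨e, rfl⟩ | ⟨hP, hQ', h⟩
  · exact ⟨e c, Or.inl ⟨e, Fin.comp_snoc e a c⟩⟩
  · obtain ⟨d, hd⟩ := h.exists_snoc (hT.aleph0Saturated hQ hQ') c
    exact ⟨d, Or.inr ⟨hP, hQ', hd⟩⟩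

theorem exists_similar (hT : Rich L T κ) (hP : P ⊨ T) {n : ℕ} (a : Fin n → P) :
    ∃ (M : Type max u v) (_ : L.Structure M) (b : Fin n → M),
      M ⊨ T ∧ Cardinal.mk M ≤ κ ∧ Similar L κ a b := by
  rcases le_or_gt (Cardinal.mk P) κ with hκ | hκ
  · exact ⟨P, inferInstance, a, hP, hκ, Or.inl ⟨Language.Equiv.refl L P, rfl⟩⟩
  · obtain ⟨S, haS, -, hS⟩ :=
      exists_elementarySubstructure_card_le P (Set.range a) hT.1 (mk_range_fin_le a hT.1)
    exact ⟨S, inferInstance, fun i => ⟨a i, haS ⟨i, rfl⟩⟩, (S.theory_model_iff T).2 hP,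
      (hS hκ.le).le, Or.inr ⟨hκ.le, (hS hκ.le).ge,
        elemEquiv_coe S fun i => ⟨a i, haS ⟨i, rfl⟩⟩⟩⟩

theorem Similar.exists_embedding (hT : Rich L T κ) (hP' : P' ⊨ T) {n : ℕ} {a : Fin n → P}
    {b : Fin n → Q} (h : Similar L κ a b) (f : P ↪[L] P') :
    ∃ (M : Type max u v) (_ : L.Structure M) (g : Q ↪[L] M),
      M ⊨ T ∧ Cardinal.mk M ≤ max κ (Cardinal.mk Q) ∧ Similar L κ (f ∘ a) (g ∘ b) := by
  have hμ : L.card + Cardinal.aleph0 ≤ max κ (Cardinal.mk Q) := hT.1.trans (le_max_left _ _)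
  rcases h with ⟨e, rfl⟩ | ⟨hP, hQ, h⟩
  · let g : Q ↪[L] P' := f.comp e.symm.toEmbedding
    have hg : ∀ x, g (e x) = f x := fun x => congrArg f (e.symm_apply_apply x)
    rcases le_or_gt (Cardinal.mk P') (max κ (Cardinal.mk Q)) with hle | hlt
    · exact ⟨P', inferInstance, g, hP', hle,
        Or.inl ⟨Language.Equiv.refl L P', funext fun i => (hg _).symm⟩⟩
    · obtain ⟨S, hgS, hS, hS'⟩ := exists_elementarySubstructure_card_le P' (Set.range g) hμ
        (Cardinal.mk_range_le.trans (le_max_right _ _))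
      refine ⟨S, inferInstance, g.codRestrict S.toSubstructure fun c => hgS ⟨c, rfl⟩,
        (S.theory_model_iff T).2 hP', hS, Or.inr ⟨(le_max_left _ _).trans hlt.le,
          (le_max_left _ _).trans (hS' hlt.le).ge, ?_⟩⟩
      convert elemEquiv_coe S _ using 1
      exact funext fun i => (hg _).symm
  · have : Nonempty P := Cardinal.mk_ne_zero_iff.1
      ((Cardinal.aleph0_pos.trans_le (le_add_self.trans hT.1)).trans_le hP).ne'
    obtain ⟨M, _, g, hg⟩ := h.exists_embedding f
    obtain ⟨S, hgS, hS, -⟩ := exists_elementarySubstructure_card_le M (Set.range g) hμ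
      (Cardinal.mk_range_le.trans (le_max_right _ _))
    let g' : Q ↪[L] S := g.codRestrict S.toSubstructure fun c => hgS ⟨c, rfl⟩
    exact ⟨S, inferInstance, g', (S.theory_model_iff T).2 (hg.models hP'), hS,
      Or.inr ⟨hP.trans (Cardinal.mk_le_of_injective f.injective),
        hQ.trans (Cardinal.mk_le_of_injective g'.injective),
        fun φ => (hg φ).trans (elemEquiv_coe S (g' ∘ b) φ)⟩⟩

end Compactness

section Ample

universe u v w x w' x'

variable {L : FirstOrder.Language.{u, v}} {T : L.Theory} {κ : Cardinal.{max u v}}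

/-- The worlds of `S` are isomorphic to small models of `T`; all models of `T` of cardinality at
most `κ` occur up to isomorphism, and so do all extensions of a world `W` to a model of `T` of
cardinality at most `max κ |W|`. -/
structure IsAmple (S : PotSys.{u, v, w, x} L) (T : L.Theory) (κ : Cardinal.{max u v}) :
    Prop where
  exists_equiv : ∀ W : S.World, ∃ (P : Type max u v) (_ : L.Structure P),
    P ⊨ T ∧ Nonempty (S.Dom W ≃[L] P)
  exists_world : ∀ (P : Type max u v) [L.Structure P], P ⊨ T → Cardinal.mk P ≤ κ →
    ∃ W : S.World, Nonempty (S.Dom W ≃[L] P)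
  exists_extension : ∀ (W : S.World) (Q P : Type max u v) [L.Structure Q] [L.Structure P]
    (e : S.Dom W ≃[L] Q) (g : Q ↪[L] P), P ⊨ T →
    Cardinal.mk P ≤ max κ (Cardinal.mk Q) →
    ∃ (W' : S.World) (ρ : S.Dom W ↪[L] S.Dom W') (e' : S.Dom W' ≃[L] P),
      ρ ∈ S.Emb W W' ∧ ∀ y, e' (ρ y) = g (e y)

/-- The relation induced by `Similar` between worlds of potentialist systems. -/
def similarRel (κ : Cardinal.{max u v}) (S : PotSys.{u, v, w, x} L)
    (S' : PotSys.{u, v, w', x'} L) : BisimRel S S' := fun _ M a N b =>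
  ∃ (P Q : Type max u v) (_ : L.Structure P) (_ : L.Structure Q) (e : S.Dom M ≃[L] P)
    (f : S'.Dom N ≃[L] Q), Similar L κ (e ∘ a) (f ∘ b)

variable {S : PotSys.{u, v, w, x} L} {S' : PotSys.{u, v, w', x'} L}

theorem similarRel.symm {n : ℕ} {M : S.World} {a : Fin n → S.Dom M} {N : S'.World}
    {b : Fin n → S'.Dom N} (h : similarRel κ S S' n M a N b) : similarRel κ S' S n N b M a := by
  obtain ⟨P, Q, _, _, e, f, h⟩ := h
  exact ⟨Q, P, _, _, f, e, h.symm⟩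

theorem similarRel.atomicEquiv {n : ℕ} {M : S.World} {a : Fin n → S.Dom M} {N : S'.World}
    {b : Fin n → S'.Dom N} (h : similarRel κ S S' n M a N b) : AtomicEquiv L a b := by
  obtain ⟨P, Q, _, _, e, f, h⟩ := h
  intro φ _
  rw [← StrongHomClass.realize_formula e φ, ← StrongHomClass.realize_formula f φ]
  exact h.elemEquiv φ

theorem IsAmple.models (hS : IsAmple S T κ) (W : S.World) {P : Type max u v} [L.Structure P]
    (e : S.Dom W ≃[L] P) : P ⊨ T := by
  obtain ⟨P', _, hP', ⟨e'⟩⟩ := hS.exists_equiv W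
  exact StrongHomClass.theory_model (e.comp e'.symm)

theorem similarRel.exists_snoc (hT : Rich L T κ) (hS' : IsAmple S' T κ) {n : ℕ} {M : S.World}
    {a : Fin n → S.Dom M} {N : S'.World} {b : Fin n → S'.Dom N}
    (h : similarRel κ S S' n M a N b) (c : S.Dom M) :
    ∃ d, similarRel κ S S' (n + 1) M (Fin.snoc a c) N (Fin.snoc b d) := by
  obtain ⟨P, Q, _, _, e, f, h⟩ := h
  obtain ⟨d, hd⟩ := h.exists_snoc hT (hS'.models N f) (e c)
  refine ⟨f.symm d, P, Q, _, _, e, f, ?_⟩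
  have he : e ∘ (Fin.snoc a c : Fin (n + 1) → S.Dom M) = Fin.snoc (e ∘ a) (e c) :=
    Fin.comp_snoc e a c
  have hf : f ∘ (Fin.snoc b (f.symm d) : Fin (n + 1) → S'.Dom N) = Fin.snoc (f ∘ b) d := by
    refine (Fin.comp_snoc f b (f.symm d)).trans ?_
    rw [f.apply_symm_apply]
  rwa [he, hf]

theorem similarRel.exists_extension (hT : Rich L T κ) (hS : IsAmple S T κ)
    (hS' : IsAmple S' T κ) {n : ℕ} {M : S.World} {a : Fin n → S.Dom M} {N : S'.World}
    {b : Fin n → S'.Dom N} (h : similarRel κ S S' n M a N b) (M' : S.World)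
    (π : S.Dom M ↪[L] S.Dom M') :
    ∃ (N' : S'.World) (ρ : S'.Dom N ↪[L] S'.Dom N'), ρ ∈ S'.Emb N N' ∧
      similarRel κ S S' n M' (fun i => π (a i)) N' (fun i => ρ (b i)) := by
  obtain ⟨P, Q, _, _, e, f, h⟩ := h
  obtain ⟨P', _, hP', ⟨e'⟩⟩ := hS.exists_equiv M'
  obtain ⟨Q', _, g, hQ', hcard, hsim⟩ := h.exists_embedding hT hP'
    (e'.toEmbedding.comp (π.comp e.symm.toEmbedding))
  obtain ⟨N', ρ, f', hρ, hf'⟩ := hS'.exists_extension N Q Q' f g hQ' hcard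
  refine ⟨N', ρ, hρ, P', Q', _, _, e', f', ?_⟩
  convert hsim using 1
  · funext i
    simp
  · exact funext fun i => hf' (b i)

theorem exists_similarRel (hT : Rich L T κ) (hS : IsAmple S T κ) (hS' : IsAmple S' T κ) {n : ℕ}
    (M : S.World) (a : Fin n → S.Dom M) : ∃ N b, similarRel κ S S' n M a N b := by
  obtain ⟨P, _, hP, ⟨e⟩⟩ := hS.exists_equiv M
  obtain ⟨Q, _, b, hQ, hcard, hsim⟩ := exists_similar hT hP (e ∘ a)
  obtain ⟨N, ⟨f⟩⟩ := hS'.exists_world Q hQ hcard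
  refine ⟨N, f.symm ∘ b, P, Q, _, _, e, f, ?_⟩
  convert hsim using 1
  exact funext fun i => f.apply_symm_apply (b i)

theorem bitotallyBisimilar_of_isAmple (hT : Rich L T κ) (hS : IsAmple S T κ)
    (hS' : IsAmple S' T κ) : BitotallyBisimilar S S' := by
  refine ⟨similarRel κ S S', ⟨?_, fun n M a N b h => ⟨h.atomicEquiv, h.exists_snoc hT hS',
    fun d => ?_, fun M' π _ => h.exists_extension hT hS hS' M' π, fun N' ρ _ => ?_⟩⟩,
    fun n M a => exists_similarRel hT hS hS' M a, fun n N b => ?_⟩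
  · obtain ⟨P, _, hP, -⟩ := hT.2.1
    obtain ⟨Q, _, -, hQ, hcard, -⟩ := exists_similar hT hP (Fin.elim0 : Fin 0 → P)
    obtain ⟨M, -⟩ := hS.exists_world Q hQ hcard
    obtain ⟨N, b, h⟩ := exists_similarRel hT hS hS' M (Fin.elim0 : Fin 0 → S.Dom M)
    exact ⟨0, M, _, N, b, h⟩
  · obtain ⟨c, hc⟩ := h.symm.exists_snoc hT hS d
    exact ⟨c, hc.symm⟩
  · obtain ⟨M', π, hπ, h'⟩ := h.symm.exists_extension hT hS' hS N' ρ
    exact ⟨M', π, hπ, h'.symm⟩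
  · obtain ⟨M, a, h⟩ := exists_similarRel hT hS' hS N b
    exact ⟨M, a, h.symm⟩

end Ample

section Sets

universe w x

theorem exists_embedding_of_not_small {B : Type x} (hB : ¬ Small.{w} B) (P : Type w) :
    Nonempty (P ↪ B) :=
  (Function.Embedding.total P B).resolve_right fun ⟨f⟩ => hB (small_of_injective f.injective)

/-- Every small structure extending a structure on a small subset of a proper class `A` is
isomorphic, over this subset, to a structure on a small subset of `A`. -/
theorem exists_extension_subset {A : Type x} (hA : ¬ Small.{w} A) (s : Set A)
    [hs : Small.{w} s] {P : Type w} (f : s ↪ P) :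
    ∃ (t : Set A) (e : t ≃ P), ∀ y : s, ∃ h : (y : A) ∈ t, e ⟨y, h⟩ = f y := by
  classical
  have hB : ¬ Small.{w} ↥(sᶜ) := fun hB => hA
    (small_of_surjective (f := (Equiv.Set.sumCompl s)) (Equiv.Set.sumCompl s).surjective)
  obtain ⟨j⟩ := exists_embedding_of_not_small hB P
  let g : P → A := fun p => if hp : ∃ y, f y = p then (hp.choose : A) else (j p : A)
  have hgf : ∀ y, g (f y) = y := fun y => by
    have hp : ∃ z, f z = f y := ⟨y, rfl⟩
    simp only [g, dif_pos hp]
    exact congrArg _ (f.injective hp.choose_spec)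
  have hgj : ∀ p, (¬ ∃ y, f y = p) → g p = j p := fun p hp => dif_neg hp
  have hg : Function.Injective g := by
    intro p q hpq
    by_cases hp : ∃ y, f y = p <;> by_cases hq : ∃ y, f y = q
    · obtain ⟨y, rfl⟩ := hp
      obtain ⟨z, rfl⟩ := hq
      rw [hgf, hgf] at hpq
      rw [Subtype.ext hpq]
    · obtain ⟨y, rfl⟩ := hp
      rw [hgf, hgj q hq] at hpq
      exact absurd (hpq ▸ y.2) (j q).2
    · obtain ⟨y, rfl⟩ := hq
      rw [hgf, hgj p hp] at hpq
      exact absurd (hpq ▸ y.2) (j p).2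
    · rw [hgj p hp, hgj q hq] at hpq
      exact j.injective (Subtype.ext hpq)
  refine ⟨Set.range g, (Equiv.ofInjective g hg).symm, fun y => ⟨⟨f y, hgf y⟩, ?_⟩⟩
  rw [Equiv.symm_apply_eq]
  exact Subtype.ext (hgf y).symm

theorem mk_le_lift_iff_of_equiv {X : Type (w + 1)} {P : Type w} (e : X ≃ P)
    {κ : Cardinal.{w}} : Cardinal.mk X ≤ Cardinal.lift.{w + 1} κ ↔ Cardinal.mk P ≤ κ := by
  have h := Cardinal.lift_mk_eq'.2 ⟨e⟩
  rw [Cardinal.lift_id'.{w, w + 1}] at h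
  rw [h, Cardinal.lift_le]

end Sets

section Systems

universe u v

variable {L : FirstOrder.Language.{u, v}} {T : L.Theory} {A : Type (max u v + 1)}

theorem CModel.exists_extension (hA : ¬ Small.{max u v} A) (s : Set A) [Small.{max u v} s]
    [L.Structure s] {P : Type max u v} [L.Structure P] (hP : P ⊨ T) (f : s ↪[L] P) :
    ∃ (W : CModel L T A) (ρ : s ↪[L] W.carrier) (e : W.carrier ≃[L] P),
      (∀ y, (ρ y : A) = y) ∧ ∀ y, e (ρ y) = f y := by
  obtain ⟨t, e, he⟩ := exists_extension_subset hA s f.toEmbedding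
  let : L.Structure t := e.symm.inducedStructure
  let e' : P ≃[L] t := e.symm.inducedStructureEquiv
  have hW : t ⊨ T := StrongHomClass.theory_model e'
  refine ⟨⟨t, small_of_injective e.injective, inferInstance, hW⟩, e'.toEmbedding.comp f,
    e'.symm, fun y => ?_, fun y => e'.symm_apply_apply _⟩
  obtain ⟨h, hy⟩ := he y
  have : e'.toEmbedding.comp f y = (⟨y, h⟩ : t) := e.symm_apply_eq.2 hy.symm
  exact congrArg Subtype.val this

theorem CModel.exists_equiv_small (W : CModel L T A) :
    ∃ (P : Type max u v) (_ : L.Structure P), P ⊨ T ∧ Nonempty (W.carrier ≃[L] P) := by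
  have := W.small
  have := W.models
  let : L.Structure (Shrink.{max u v} W.carrier) := (equivShrink W.carrier).inducedStructure
  let e : W.carrier ≃[L] Shrink.{max u v} W.carrier :=
    (equivShrink W.carrier).inducedStructureEquiv
  exact ⟨_, inferInstance, StrongHomClass.theory_model e, ⟨e⟩⟩

theorem CModel.exists_equiv (hA : ¬ Small.{max u v} A) (P : Type max u v) [L.Structure P]
    (hP : P ⊨ T) : ∃ W : CModel L T A, Nonempty (W.carrier ≃[L] P) := by
  obtain ⟨j⟩ := exists_embedding_of_not_small hA P
  let i : P ≃ Set.range j := Equiv.ofInjective j j.injective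
  let : L.Structure (Set.range j) := i.inducedStructure
  let e : P ≃[L] Set.range j := i.inducedStructureEquiv
  have hW : Set.range j ⊨ T := StrongHomClass.theory_model e
  exact ⟨⟨Set.range j, inferInstance, inferInstance, hW⟩, ⟨e.symm⟩⟩

theorem isAmple_modSub (hA : ¬ Small.{max u v} A) {κ : Cardinal.{max u v}} :
    IsAmple (ModSub L T A) T κ where
  exists_equiv W := CModel.exists_equiv_small W
  exists_world P _ hP _ := CModel.exists_equiv hA P hP
  exists_extension (W : CModel L T A) Q P _ _ (e : W.carrier ≃[L] Q) g hP _ := by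
    have := W.small
    obtain ⟨W', ρ, e', hρ, he'⟩ :=
      CModel.exists_extension hA W.carrier hP (g.comp e.toEmbedding)
    exact ⟨W', ρ, e', hρ, he'⟩

theorem isAmple_modSubLe (hA : ¬ Small.{max u v} A) {κ : Cardinal.{max u v}} :
    IsAmple (ModSubLe L T A κ) T κ where
  exists_equiv W := CModel.exists_equiv_small W.1
  exists_world P _ hP hκ := by
    obtain ⟨W, ⟨e⟩⟩ := CModel.exists_equiv (T := T) hA P hP
    exact ⟨⟨W, (mk_le_lift_iff_of_equiv e.toEquiv).2 hκ⟩, ⟨e⟩⟩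
  exists_extension W Q P _ _ e g hP hcard := by
    have := W.1.small
    obtain ⟨W', ρ, e', hρ, he'⟩ :=
      CModel.exists_extension hA W.1.carrier hP (g.comp e.toEmbedding)
    have hQ : Cardinal.mk Q ≤ κ := (mk_le_lift_iff_of_equiv e.toEquiv).1 W.2
    exact ⟨⟨W', (mk_le_lift_iff_of_equiv e'.toEquiv).2 (hcard.trans (max_le le_rfl hQ))⟩,
      ρ, e', hρ, he'⟩

/-- The set-sized potentialist system of the models of `T` carried on subsets of a fixed set of
cardinality `κ`, with all embeddings between them. -/
def smallModels (T : L.Theory) (κ : Cardinal.{max u v}) :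
    PotSys.{u, v, max u v, max u v} L where
  World := Σ s : Set κ.out, {str : L.Structure s // @Theory.Model L s str T}
  Dom W := W.1
  str W := W.2.1
  Emb _ _ := Set.univ
  id_mem _ := trivial
  comp_mem _ _ _ _ := trivial

theorem isAmple_smallModels (T : L.Theory) (κ : Cardinal.{max u v}) :
    IsAmple (smallModels T κ) T κ := by
  have key : ∀ (P : Type max u v) [L.Structure P], P ⊨ T → Cardinal.mk P ≤ κ →
      ∃ W : (smallModels T κ).World, Nonempty ((smallModels T κ).Dom W ≃[L] P) := by
    intro P _ hP hκ
    obtain ⟨j⟩ : Nonempty (P ↪ κ.out) := by rwa [← Cardinal.le_def, Cardinal.mk_out]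
    let i : P ≃ Set.range j := Equiv.ofInjective j j.injective
    let : L.Structure (Set.range j) := i.inducedStructure
    let e : P ≃[L] Set.range j := i.inducedStructureEquiv
    have hW : Set.range j ⊨ T := StrongHomClass.theory_model e
    exact ⟨⟨Set.range j, inferInstance, hW⟩, ⟨e.symm⟩⟩
  refine ⟨fun W => ⟨W.1, W.2.1, W.2.2, ⟨Language.Equiv.refl L _⟩⟩, key,
    fun W Q P _ _ e g hP hcard => ?_⟩
  have hQ : Cardinal.mk Q ≤ κ :=
    (Cardinal.mk_congr e.toEquiv).symm.trans_le
      ((Cardinal.mk_subtype_le W.1).trans_eq (Cardinal.mk_out κ))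
  obtain ⟨W', ⟨e'⟩⟩ := key P hP (hcard.trans (max_le le_rfl hQ))
  exact ⟨W', e'.symm.toEmbedding.comp (g.comp e.toEmbedding), e', trivial,
    fun y => e'.apply_symm_apply _⟩

end Systems

/-- if a first-order `L`-theory `T` is `κ`-rich, then `Mod(T)` is bitotally
bisimilar with `Mod_{κ⁺}(T)`, the subsystem of models of cardinality at most `κ`; in
particular `Mod(T)` is bitotally bisimilar with a set-sized potentialist system. -/
theorem rich_bitotallyBisimilar_set_sized.{u, v}
    (L : FirstOrder.Language.{u, v}) (T : L.Theory) (A : Type (max u v + 1))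
    (hA : ¬ Small.{max u v} A) (κ : Cardinal.{max u v}) (h : Rich L T κ) :
    BitotallyBisimilar (ModSub L T A) (ModSubLe L T A κ) ∧
    ∃ N : PotSys.{u, v, max u v, max u v} L, BitotallyBisimilar (ModSub L T A) N := by
  exact ⟨bitotallyBisimilar_of_isAmple h (isAmple_modSub hA) (isAmple_modSubLe hA),
    smallModels T κ, bitotallyBisimilar_of_isAmple h (isAmple_modSub hA)
      (isAmple_smallModels T κ)⟩

end Potentialist
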